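/- arXiv:2008.04466 — 9 statements merged into one kernel-verified Lean document; each statement's English description precedes it below -/
import Mathlib

section
/- Let μ be a σ-finite measure on a measurable space (T, Σ) with μ(T) > 0, let φ be a deformed exponential, and let u₀ : T → (0,∞) be a measurable function satisfying condition (C) for φ. Then for every α ∈ (0,1) and all p, q ∈ P_μ there exists a unique real number κ ≥ 0 such that ∫_T φ(α·φ⁻¹(p) + (1−α)·φ⁻¹(q) + κ·u₀) dμ = 1. -/
open MeasureTheory Filter Set

/-- For a σ-finite measure `μ` with `μ(T) > 0`, a deformed exponential `φ`
(convex, nonnegative, vanishing at `-∞`, unbounded at `+∞`) with inverse `φinv` on the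
set where it is positive, and a measurable positive function `u₀` satisfying condition (C),
for every `α ∈ (0,1)` and all densities `p, q ∈ P_μ` there exists a unique `κ ≥ 0` with
`∫ φ(α φ⁻¹(p) + (1-α) φ⁻¹(q) + κ u₀) dμ = 1`. -/
theorem renyi_kappa_exists_unique
    {T : Type*} [MeasurableSpace T] (μ : Measure T) [SigmaFinite μ]
    (hμpos : 0 < μ Set.univ)
    (φ : ℝ → ℝ) (hconv : ConvexOn ℝ Set.univ φ) (hnonneg : ∀ u, 0 ≤ φ u)
    (hbot : Tendsto φ atBot (nhds 0)) (htop : Tendsto φ atTop atTop)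
    (φinv : ℝ → ℝ) (hinv₁ : ∀ v : ℝ, 0 < v → φ (φinv v) = v)
    (hinv₂ : ∀ u : ℝ, 0 < φ u → φinv (φ u) = u)
    (u₀ : T → ℝ) (hu₀meas : Measurable u₀) (hu₀pos : ∀ t, 0 < u₀ t)
    (hC : ∀ c : T → ℝ, Measurable c →
      (∫⁻ t, ENNReal.ofReal (φ (c t)) ∂μ < ⊤) →
      ∀ lam : ℝ, 0 < lam → ∫⁻ t, ENNReal.ofReal (φ (c t + lam * u₀ t)) ∂μ < ⊤)
    (α : ℝ) (hα : α ∈ Set.Ioo (0 : ℝ) 1)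
    (p : T → ℝ) (hpmeas : Measurable p) (hppos : ∀ᵐ t ∂μ, 0 < p t)
    (hpint : ∫⁻ t, ENNReal.ofReal (p t) ∂μ = 1)
    (q : T → ℝ) (hqmeas : Measurable q) (hqpos : ∀ᵐ t ∂μ, 0 < q t)
    (hqint : ∫⁻ t, ENNReal.ofReal (q t) ∂μ = 1) :
    ∃! κ : ℝ, 0 ≤ κ ∧
      ∫⁻ t, ENNReal.ofReal
        (φ (α * φinv (p t) + (1 - α) * φinv (q t) + κ * u₀ t)) ∂μ = 1 := by
  obtain ⟨hα0, hα1⟩ := hα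
  have hmono : Monotone φ := by
    intro a b hab
    by_contra hlt
    push Not at hlt
    have h1 : ∀ x ≤ a, φ a ≤ φ x := by
      intro x hx
      have := hconv.le_max_of_mem_Icc (x := x) (y := b) (z := a) (mem_univ _) (mem_univ _) ⟨hx, hab⟩
      rcases le_max_iff.1 this with h | h
      · exact h
      · linarith
    have h2 : φ a ≤ 0 := ge_of_tendsto hbot ((eventually_le_atBot a).mono h1)
    linarith [hnonneg b]
  have hstrict : ∀ a b, a < b → 0 < φ b → φ a < φ b := by
    intro a b hab hb
    refine lt_of_le_of_ne (hmono hab.le) fun h => ?_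
    have h1 := hinv₂ a (h ▸ hb)
    have h2 := hinv₂ b hb
    rw [h, h2] at h1
    exact hab.ne' h1
  have hcont : Continuous φ := by
    rw [← continuousOn_univ]
    exact hconv.continuousOn isOpen_univ
  have hinvmono : MonotoneOn φinv (Ioi 0) := by
    intro a ha b hb hab
    by_contra hlt
    push Not at hlt
    have := hstrict _ _ hlt (by rw [hinv₁ a ha]; exact ha)
    rw [hinv₁ a ha, hinv₁ b hb] at this
    linarith
  have hcompmeas : ∀ r : T → ℝ, Measurable r → (∀ᵐ t ∂μ, 0 < r t) →
      AEMeasurable (fun t => φinv (r t)) μ := by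
    intro r hr hrpos
    have h1 := aemeasurable_restrict_of_monotoneOn (μ := μ.map r) measurableSet_Ioi hinvmono
    rw [Measure.restrict_eq_self_of_ae_mem] at h1
    · exact h1.comp_measurable hr
    · exact (ae_map_iff hr.aemeasurable measurableSet_Ioi).2 hrpos
  have hcm : AEMeasurable (fun t => α * φinv (p t) + (1 - α) * φinv (q t)) μ :=
    ((hcompmeas p hpmeas hppos).const_mul α).add ((hcompmeas q hqmeas hqpos).const_mul (1 - α))
  have hle : ∫⁻ t, ENNReal.ofReal (φ (α * φinv (p t) + (1 - α) * φinv (q t))) ∂μ ≤ 1 := by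
    calc _ ≤ ∫⁻ t, (ENNReal.ofReal α * ENNReal.ofReal (p t)
            + ENNReal.ofReal (1 - α) * ENNReal.ofReal (q t)) ∂μ := by
          refine lintegral_mono_ae ?_
          filter_upwards [hppos, hqpos] with t hp hq
          rw [← ENNReal.ofReal_mul hα0.le, ← ENNReal.ofReal_mul (by linarith),
            ← ENNReal.ofReal_add (by positivity) (mul_nonneg (by linarith) hq.le)]
          refine ENNReal.ofReal_le_ofReal ?_
          have := hconv.2 (mem_univ (φinv (p t))) (mem_univ (φinv (q t))) hα0.le
            (by linarith : 0 ≤ 1 - α) (by ring)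
          simpa [hinv₁ _ hp, hinv₁ _ hq] using this
      _ = 1 := by
          rw [lintegral_add_left (by fun_prop), lintegral_const_mul _ (by fun_prop),
            lintegral_const_mul _ (by fun_prop), hpint, hqint, mul_one, mul_one,
            ← ENNReal.ofReal_add hα0.le (by linarith)]
          simp
  obtain ⟨c, hc, hcae⟩ := hcm
  have hF : ∀ κ : ℝ, ∫⁻ t, ENNReal.ofReal
        (φ (α * φinv (p t) + (1 - α) * φinv (q t) + κ * u₀ t)) ∂μ
      = ∫⁻ t, ENNReal.ofReal (φ (c t + κ * u₀ t)) ∂μ := by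
    intro κ
    refine lintegral_congr_ae ?_
    filter_upwards [hcae] with t ht
    rw [ht]
  have hle' : ∫⁻ t, ENNReal.ofReal (φ (c t)) ∂μ ≤ 1 := by
    have := hF 0
    simp only [zero_mul, add_zero] at this
    rwa [← this]
  simp only [hF]
  clear hF hle hcae
  have hfin := hC c hc (hle'.trans_lt ENNReal.one_lt_top)
  have hmeas : ∀ κ : ℝ, Measurable fun t => ENNReal.ofReal (φ (c t + κ * u₀ t)) := by
    intro κ
    exact ENNReal.measurable_ofReal.comp (hcont.measurable.comp (hc.add (hu₀meas.const_mul κ)))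
  have hpt : ∀ t, ∀ a b : ℝ, a ≤ b →
      ENNReal.ofReal (φ (c t + a * u₀ t)) ≤ ENNReal.ofReal (φ (c t + b * u₀ t)) := by
    intro t a b hab
    refine ENNReal.ofReal_le_ofReal (hmono ?_)
    have := mul_le_mul_of_nonneg_right hab (hu₀pos t).le
    linarith
  have huniq : ∀ a b : ℝ, a < b →
      ∫⁻ t, ENNReal.ofReal (φ (c t + a * u₀ t)) ∂μ = 1 →
      ∫⁻ t, ENNReal.ofReal (φ (c t + b * u₀ t)) ∂μ = 1 → False := by
    intro a b hab ha hb
    have hae := ae_eq_of_ae_le_of_lintegral_le (μ := μ)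
      (Eventually.of_forall fun t => hpt t a b hab.le) (by rw [ha]; simp)
      (hmeas b).aemeasurable (by rw [ha, hb])
    have hz : ∫⁻ t, ENNReal.ofReal (φ (c t + b * u₀ t)) ∂μ = 0 := by
      rw [lintegral_eq_zero_iff (hmeas b)]
      filter_upwards [hae] with t ht
      by_contra hne
      have hpos : 0 < φ (c t + b * u₀ t) := by
        by_contra hn
        exact hne (ENNReal.ofReal_of_nonpos (not_lt.1 hn))
      have hlt : c t + a * u₀ t < c t + b * u₀ t := by
        have := mul_lt_mul_of_pos_right hab (hu₀pos t)
        linarith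
      have := (ENNReal.ofReal_lt_ofReal_iff hpos).2 (hstrict _ _ hlt hpos)
      exact this.ne ht
    rw [hz] at hb
    exact zero_ne_one hb
  have hlim : Tendsto (fun n : ℕ => ∫⁻ t, ENNReal.ofReal (φ (c t + (n : ℝ) * u₀ t)) ∂μ)
      atTop (nhds ⊤) := by
    have h := lintegral_tendsto_of_tendsto_of_monotone (μ := μ)
      (f := fun (n : ℕ) t => ENNReal.ofReal (φ (c t + (n : ℝ) * u₀ t))) (F := fun _ => ⊤)
      (fun n => (hmeas n).aemeasurable)
      (Eventually.of_forall fun t m n hmn => hpt t m n (by exact_mod_cast hmn))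
      (Eventually.of_forall fun t => ENNReal.tendsto_ofReal_atTop.comp (htop.comp
        (tendsto_atTop_add_const_left _ _
          (tendsto_natCast_atTop_atTop.atTop_mul_const (hu₀pos t)))))
    rwa [lintegral_const, ENNReal.top_mul hμpos.ne'] at h
  obtain ⟨K, hK, hK1⟩ := ((hlim.eventually (lt_mem_nhds ENNReal.one_lt_top)).and
    (eventually_ge_atTop 1)).exists
  have hK0 : (0 : ℝ) < K := by exact_mod_cast hK1
  have hcF : ContinuousOn (fun κ : ℝ => ∫⁻ t, ENNReal.ofReal (φ (c t + κ * u₀ t)) ∂μ)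
      (Icc 0 (K : ℝ)) := by
    intro x hx
    refine tendsto_lintegral_filter_of_dominated_convergence
      (fun t => ENNReal.ofReal (φ (c t + (K : ℝ) * u₀ t)))
      (Eventually.of_forall fun κ => hmeas κ) ?_ (hfin K hK0).ne ?_
    · filter_upwards [self_mem_nhdsWithin] with κ hκ
      exact Eventually.of_forall fun t => hpt t κ K hκ.2
    · refine Eventually.of_forall fun t => ?_
      have : Continuous fun κ : ℝ => ENNReal.ofReal (φ (c t + κ * u₀ t)) :=
        ENNReal.continuous_ofReal.comp (hcont.comp (by fun_prop))
      exact this.continuousWithinAt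
  obtain ⟨κ, hκ, hκ1⟩ := intermediate_value_Icc hK0.le hcF
    (show (1 : ENNReal) ∈ _ from ⟨by simpa using hle', hK.le⟩)
  refine ⟨κ, ⟨hκ.1, hκ1⟩, ?_⟩
  rintro y ⟨-, hy⟩
  rcases lt_trichotomy y κ with h | h | h
  · exact (huniq _ _ h hy hκ1).elim
  · exact h
  · exact (huniq _ _ h hκ1 hy).elim
end

section
/- Let μ be a σ-finite measure, let φ be a deformed exponential, and let u₀ : T → (0,∞) be measurable. If φ and u₀ do NOT satisfy condition (C), then there exist a measurable function c : T → ℝ with ∫_T φ(c) dμ < ∞ and a constant λ₀ ≥ 0 such that either (i) ∫_T φ(c + λu₀) dμ < ∞ for all 0 ≤ λ ≤ λ₀ and ∫_T φ(c + λu₀) dμ = ∞ for all λ > λ₀, or (ii) λ₀ > 0, ∫_T φ(c + λu₀) dμ < ∞ for all 0 ≤ λ < λ₀, and ∫_T φ(c + λu₀) dμ = ∞ for all λ ≥ λ₀. -/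
open MeasureTheory Filter Set

/-- If a deformed exponential `φ` and a measurable positive `u₀` do NOT satisfy
condition (C), then there is a measurable `c` with `∫ φ(c) dμ < ∞` and a `λ₀ ≥ 0` such that
either (i) `∫ φ(c + λ u₀) dμ < ∞` for `0 ≤ λ ≤ λ₀` and `= ∞` for `λ > λ₀`, or
(ii) `λ₀ > 0`, `∫ φ(c + λ u₀) dμ < ∞` for `0 ≤ λ < λ₀` and `= ∞` for `λ ≥ λ₀`. -/
theorem not_condC_dichotomy
    {T : Type*} [MeasurableSpace T] (μ : Measure T) [SigmaFinite μ]
    (φ : ℝ → ℝ) (hconv : ConvexOn ℝ Set.univ φ) (hnonneg : ∀ u, 0 ≤ φ u)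
    (hbot : Tendsto φ atBot (nhds 0)) (htop : Tendsto φ atTop atTop)
    (u₀ : T → ℝ) (hu₀meas : Measurable u₀) (hu₀pos : ∀ t, 0 < u₀ t)
    (hnotC : ¬ (∀ c : T → ℝ, Measurable c →
      (∫⁻ t, ENNReal.ofReal (φ (c t)) ∂μ < ⊤) →
      ∀ lam : ℝ, 0 < lam → ∫⁻ t, ENNReal.ofReal (φ (c t + lam * u₀ t)) ∂μ < ⊤)) :
    ∃ c : T → ℝ, Measurable c ∧ (∫⁻ t, ENNReal.ofReal (φ (c t)) ∂μ < ⊤) ∧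
      ∃ lam₀ : ℝ, 0 ≤ lam₀ ∧
        (((∀ lam : ℝ, 0 ≤ lam → lam ≤ lam₀ →
            ∫⁻ t, ENNReal.ofReal (φ (c t + lam * u₀ t)) ∂μ < ⊤) ∧
          (∀ lam : ℝ, lam₀ < lam →
            ∫⁻ t, ENNReal.ofReal (φ (c t + lam * u₀ t)) ∂μ = ⊤)) ∨
         (0 < lam₀ ∧
          (∀ lam : ℝ, 0 ≤ lam → lam < lam₀ →
            ∫⁻ t, ENNReal.ofReal (φ (c t + lam * u₀ t)) ∂μ < ⊤) ∧
          (∀ lam : ℝ, lam₀ ≤ lam →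
            ∫⁻ t, ENNReal.ofReal (φ (c t + lam * u₀ t)) ∂μ = ⊤))) := by
  have hmono : Monotone φ := by
    intro x y hxy
    by_contra! h
    have hlt : x < y := lt_of_le_of_ne hxy (by rintro rfl; exact lt_irrefl _ h)
    have hx : 0 < φ x := lt_of_le_of_lt (hnonneg y) h
    have h1 : ∀ᶠ z in atBot, φ z < φ x := hbot.eventually (gt_mem_nhds hx)
    obtain ⟨z, hz, hzx⟩ := (h1.and (eventually_lt_atBot x)).exists
    have h2 : φ x ≤ max (φ z) (φ y) :=
      hconv.le_max_of_mem_Icc (mem_univ z) (mem_univ y) ⟨hzx.le, hlt.le⟩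
    exact absurd h2 (not_le.mpr (max_lt hz h))
  push Not at hnotC
  obtain ⟨c, hc, hfin, lam, hlam, hinf⟩ := hnotC
  refine ⟨c, hc, hfin, ?_⟩
  have hle : ∀ a b : ℝ, a ≤ b → ∫⁻ t, ENNReal.ofReal (φ (c t + a * u₀ t)) ∂μ ≤
      ∫⁻ t, ENNReal.ofReal (φ (c t + b * u₀ t)) ∂μ := by
    intro a b hab
    refine lintegral_mono fun t => ENNReal.ofReal_le_ofReal (hmono ?_)
    have := mul_le_mul_of_nonneg_right hab (hu₀pos t).le
    linarith
  set S : Set ℝ := {a | 0 ≤ a ∧ ∫⁻ t, ENNReal.ofReal (φ (c t + a * u₀ t)) ∂μ < ⊤} with hS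
  have h0 : (0 : ℝ) ∈ S := ⟨le_rfl, by simpa using hfin⟩
  have hbdd : BddAbove S := by
    refine ⟨lam, fun a ha => ?_⟩
    by_contra! h
    exact absurd (lt_of_le_of_lt (hle _ _ h.le) ha.2) (not_lt.mpr hinf)
  have hs0 : 0 ≤ sSup S := le_csSup hbdd h0
  have habove : ∀ a : ℝ, sSup S < a →
      ∫⁻ t, ENNReal.ofReal (φ (c t + a * u₀ t)) ∂μ = ⊤ := by
    intro a ha
    by_contra h
    exact absurd (le_csSup hbdd (show a ∈ S from ⟨hs0.trans ha.le, lt_top_iff_ne_top.mpr h⟩))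
      (not_le.mpr ha)
  refine ⟨sSup S, hs0, ?_⟩
  by_cases hm : sSup S ∈ S
  · exact Or.inl ⟨fun a _ h => lt_of_le_of_lt (hle _ _ h) hm.2, habove⟩
  · refine Or.inr ⟨lt_of_le_of_ne hs0 fun h => hm (h ▸ h0), fun a _ ha => ?_, fun a ha => ?_⟩
    · obtain ⟨b, hb, hab⟩ := exists_lt_of_lt_csSup ⟨0, h0⟩ ha
      exact lt_of_le_of_lt (hle _ _ hab.le) hb.2
    · by_contra h
      exact hm ⟨hs0, lt_of_le_of_lt (hle _ _ ha) (lt_top_iff_ne_top.mpr h)⟩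
end

section
/- Assume the measure μ is non-atomic and σ-finite, let φ be a deformed exponential, and let u₀ : T → (0,∞) be measurable. Then φ and u₀ satisfy condition (C) if, and only if, for some constant α ∈ (0,1) there exists a measurable function c : T → ℝ ∪ {−∞} such that ∫_T φ(c) dμ < ∞ (with the convention φ(−∞) = 0) and, for μ-a.e. t ∈ T, the inequality α·φ(u) ≤ φ(u − u₀(t)) holds for all real u ≥ c(t). -/
open MeasureTheory Filter Set

/-- The deformed exponential `φ` extended to `ℝ ∪ {−∞}` (as a subset of `EReal`),
with the convention `φ(−∞) = 0`, valued in `ℝ≥0∞` for integration. -/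
noncomputable def phiE (φ : ℝ → ℝ) : EReal → ENNReal :=
  fun x => if x = ⊥ then 0 else ENNReal.ofReal (φ x.toReal)

open scoped ENNReal NNReal

/-- Small subsets of positive measure. -/
lemma aux_small {T : Type*} [MeasurableSpace T] (μ : Measure T)
    (hna : ∀ A : Set T, MeasurableSet A → 0 < μ A →
      ∃ B ⊆ A, MeasurableSet B ∧ 0 < μ B ∧ μ B < μ A)
    (A : Set T) (hA : MeasurableSet A) (hpos : 0 < μ A) (ε : ℝ≥0∞) (hε : 0 < ε) :
    ∃ D ⊆ A, MeasurableSet D ∧ 0 < μ D ∧ μ D ≤ ε := by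
  obtain ⟨B, hBA, hB, hB0, hBlt⟩ := hna A hA hpos
  have hBfin : μ B ≠ ⊤ := (lt_of_lt_of_le hBlt le_top).ne
  have key : ∀ n : ℕ, ∃ D ⊆ B, MeasurableSet D ∧ 0 < μ D ∧ 2 ^ n * μ D ≤ μ B := by
    intro n
    induction n with
    | zero => exact ⟨B, subset_rfl, hB, hB0, by simp⟩
    | succ n ih =>
      obtain ⟨D, hDB, hD, hD0, hDle⟩ := ih
      obtain ⟨E, hED, hE, hE0, hElt⟩ := hna D hD hD0
      have hsum : μ E + μ (D \ E) = μ D := by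
        rw [← measure_inter_add_diff D hE, inter_eq_self_of_subset_right hED]
      have hdiff : 0 < μ (D \ E) := by
        rw [pos_iff_ne_zero]
        intro h0
        rw [h0, add_zero] at hsum
        exact hElt.ne hsum
      rcases le_total (μ E) (μ (D \ E)) with h | h
      · refine ⟨E, hED.trans hDB, hE, hE0, le_trans ?_ hDle⟩
        rw [pow_succ, mul_assoc, ← hsum, two_mul]
        gcongr
      · refine ⟨D \ E, diff_subset.trans hDB, hD.diff hE, hdiff, le_trans ?_ hDle⟩
        rw [pow_succ, mul_assoc, ← hsum, two_mul]
        gcongr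
  have hlim : ∃ n : ℕ, μ B ≤ ε * 2 ^ n := by
    by_cases hεt : ε = ⊤
    · exact ⟨0, by simp [hεt]⟩
    obtain ⟨n, hn⟩ := ENNReal.exists_nat_mul_gt hε.ne' hBfin
    refine ⟨n, hn.le.trans ?_⟩
    rw [mul_comm]
    gcongr
    exact_mod_cast Nat.lt_two_pow_self.le
  obtain ⟨n, hn⟩ := hlim
  obtain ⟨D, hDB, hD, hD0, hDle⟩ := key n
  refine ⟨D, hDB.trans hBA, hD, hD0, ?_⟩
  have h2 : (2 : ℝ≥0∞) ^ n * μ D ≤ 2 ^ n * ε := by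
    rw [mul_comm _ ε]; exact hDle.trans hn
  exact (ENNReal.mul_le_mul_iff_right (by simp) (by simp)).1 h2

/-- A weak form of the Sierpinski theorem. -/
lemma aux_between {T : Type*} [MeasurableSpace T] (ν : Measure T)
    (hsmall : ∀ A : Set T, MeasurableSet A → 0 < ν A → ∀ ε : ℝ≥0∞, 0 < ε →
      ∃ D ⊆ A, MeasurableSet D ∧ 0 < ν D ∧ ν D ≤ ε)
    (M : ℝ≥0∞) (hM0 : 0 < M) (hMt : M ≠ ⊤) (hMν : M ≤ ν univ) :
    ∃ B, MeasurableSet B ∧ M ≤ ν B ∧ ν B ≤ 2 * M := by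
  by_contra hcon
  have key : ∀ B, MeasurableSet B → ν B ≤ 2 * M → ν B < M := by
    intro B hB h
    by_contra h'
    exact hcon ⟨B, hB, not_lt.1 h', h⟩
  let S : Set ℝ≥0∞ := {x | ∃ B, MeasurableSet B ∧ ν B < M ∧ ν B = x}
  have hSne : S.Nonempty := ⟨0, ∅, MeasurableSet.empty, by simpa using hM0, by simp⟩
  obtain ⟨x, -, hxlim, hxS⟩ := exists_seq_tendsto_sSup hSne (OrderTop.bddAbove S)
  choose D hD hDM hDx using hxS
  have hacc : ∀ n, MeasurableSet (Set.accumulate D n) ∧ ν (Set.accumulate D n) < M := by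
    intro n
    induction n with
    | zero => simpa using ⟨hD 0, hDM 0⟩
    | succ n ih =>
      rw [Set.accumulate_succ]
      refine ⟨ih.1.union (hD _), key _ (ih.1.union (hD _)) ?_⟩
      refine (measure_union_le _ _).trans ?_
      rw [two_mul]
      exact add_le_add ih.2.le (hDM _).le
  have hU : MeasurableSet (⋃ n, D n) := MeasurableSet.iUnion hD
  have hUM : ν (⋃ n, D n) < M := by
    refine key _ hU ?_
    rw [← Set.iUnion_accumulate, (Set.monotone_accumulate).measure_iUnion]
    refine iSup_le fun n => (hacc n).2.le.trans ?_
    rw [two_mul]; exact le_self_add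
  have hUs : sSup S ≤ ν (⋃ n, D n) := by
    refine le_of_tendsto' hxlim fun n => ?_
    rw [← hDx n]
    exact measure_mono (subset_iUnion D n)
  have hc : 0 < ν (⋃ n, D n)ᶜ := by
    rw [pos_iff_ne_zero]
    intro h0
    have := measure_add_measure_compl (μ := ν) hU
    rw [h0, add_zero] at this
    rw [← this] at hMν
    exact absurd hUM (not_lt.2 hMν)
  obtain ⟨E, hE, hEm, hE0, hEM⟩ := hsmall _ hU.compl hc M hM0
  have hdis : Disjoint (⋃ n, D n) E := (disjoint_compl_right).mono_right hE
  have hsum : ν ((⋃ n, D n) ∪ E) = ν (⋃ n, D n) + ν E := measure_union hdis hEm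
  have h1 : ν ((⋃ n, D n) ∪ E) < M := by
    refine key _ (hU.union hEm) ?_
    rw [hsum, two_mul]
    exact add_le_add hUM.le hEM
  have h2 : ν ((⋃ n, D n) ∪ E) ≤ sSup S := le_sSup ⟨_, hU.union hEm, h1, rfl⟩
  have h3 : ν (⋃ n, D n) < ν ((⋃ n, D n) ∪ E) := by
    rw [hsum]
    exact ENNReal.lt_add_right (hUM.trans_le le_top).ne hE0.ne'
  exact absurd (h3.trans_le (h2.trans hUs)) (lt_irrefl _)

/-- Restricting a bounded function to a set so that its integral is of a given size. -/
lemma aux_restrict {T : Type*} [MeasurableSpace T] (μ : Measure T)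
    (hna : ∀ A : Set T, MeasurableSet A → 0 < μ A →
      ∃ B ⊆ A, MeasurableSet B ∧ 0 < μ B ∧ μ B < μ A)
    (F : T → ℝ≥0∞) (hF : Measurable F) (K : ℝ≥0∞) (hK : K ≠ ⊤) (hFK : ∀ t, F t ≤ K)
    (M : ℝ≥0∞) (hM0 : 0 < M) (hMt : M ≠ ⊤) (hMF : M ≤ ∫⁻ t, F t ∂μ) :
    ∃ B, MeasurableSet B ∧ M ≤ ∫⁻ t in B, F t ∂μ ∧ ∫⁻ t in B, F t ∂μ ≤ 2 * M := by
  have h := aux_between (μ.withDensity F) ?_ M hM0 hMt ?_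
  · obtain ⟨B, hB, h1, h2⟩ := h
    rw [withDensity_apply _ hB] at h1 h2
    exact ⟨B, hB, h1, h2⟩
  · intro A hA hA0 ε hε
    have hms : MeasurableSet (A ∩ {t | F t ≠ 0}) :=
      hA.inter (hF (measurableSet_singleton (0 : ℝ≥0∞)).compl)
    have hpos : 0 < μ (A ∩ {t | F t ≠ 0}) := by
      rw [pos_iff_ne_zero] at hA0 ⊢
      intro h0
      apply hA0
      rw [withDensity_apply_eq_zero hF, inter_comm]
      exact h0
    obtain ⟨D, hDA, hD, hD0, hDε⟩ := aux_small μ hna _ hms hpos (ε / K)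
      (ENNReal.div_pos hε.ne' hK)
    refine ⟨D, hDA.trans inter_subset_left, hD, ?_, ?_⟩
    · rw [pos_iff_ne_zero]
      intro h0
      rw [withDensity_apply_eq_zero hF] at h0
      rw [inter_eq_self_of_subset_right (fun t ht => (hDA ht).2)] at h0
      exact hD0.ne' h0
    · rw [withDensity_apply _ hD]
      calc ∫⁻ t in D, F t ∂μ ≤ ∫⁻ t in D, K ∂μ := lintegral_mono hFK
        _ = K * μ D := by rw [setLIntegral_const]
        _ ≤ K * (ε / K) := by gcongr
        _ ≤ ε := ENNReal.mul_div_le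
  · rw [withDensity_apply _ MeasurableSet.univ]
    simpa using hMF

lemma aux_mono (φ : ℝ → ℝ) (hconv : ConvexOn ℝ Set.univ φ) (hnonneg : ∀ u, 0 ≤ φ u)
    (hbot : Tendsto φ atBot (nhds 0)) : Monotone φ := by
  intro x y hxy
  by_contra hlt
  push Not at hlt
  have h1 : ∀ z ≤ x, φ x ≤ φ z := by
    intro z hz
    have := hconv.le_max_of_mem_Icc (mem_univ z) (mem_univ y) (z := x) ⟨hz, hxy⟩
    rcases le_max_iff.1 this with h | h
    · exact h
    · exact absurd hlt (not_lt.2 h)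
  have h2 : φ x ≤ 0 := by
    refine ge_of_tendsto hbot ?_
    filter_upwards [eventually_le_atBot x] with z hz using h1 z hz
  linarith [hnonneg y]

lemma aux_base {T : Type*} [MeasurableSpace T] (μ : Measure T) [SigmaFinite μ]
    (φ : ℝ → ℝ) (hbot : Tendsto φ atBot (nhds 0)) :
    ∃ b : T → ℝ, Measurable b ∧ ∫⁻ t, ENNReal.ofReal (φ (b t)) ∂μ < ⊤ := by
  obtain ⟨g, hg0, hg, hgi⟩ := exists_pos_lintegral_lt_of_sigmaFinite μ (one_ne_zero)
  have ha : ∀ k : ℕ, ∃ a : ℝ, φ a < 1 / ((k : ℝ) + 1) := fun k =>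
    (hbot.eventually (gt_mem_nhds (by positivity : (0 : ℝ) < 1 / ((k : ℝ) + 1)))).exists
  choose a ha using ha
  refine ⟨fun t => a (⌈(g t)⁻¹⌉₊), ?_, ?_⟩
  · exact (measurable_from_top (f := a)).comp (Nat.measurable_ceil.comp hg.inv)
  · refine lt_of_le_of_lt (lintegral_mono fun t => ?_) (hgi.trans ENNReal.one_lt_top)
    have hgt : (0 : ℝ) < g t := hg0 t
    rw [← ENNReal.ofReal_coe_nnreal]
    apply ENNReal.ofReal_le_ofReal
    refine (ha _).le.trans ?_
    rw [div_le_iff₀ (by positivity)]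
    have h1 : (g t : ℝ)⁻¹ ≤ (⌈(g t)⁻¹⌉₊ : ℝ) := by exact_mod_cast Nat.le_ceil ((g t)⁻¹)
    have h2 : (g t : ℝ) * (g t : ℝ)⁻¹ = 1 := mul_inv_cancel₀ hgt.ne'
    nlinarith

/-- If monotone continuous `φ` is bounded along a family then also at its supremum. -/
lemma aux_sup {ι : Type*} [Nonempty ι] (φ : ℝ → ℝ) (hcont : Continuous φ) (s : ι → ℝ)
    (hb : BddAbove (range s)) (H : ℝ) (h : ∀ i, φ (s i) ≤ H) : φ (⨆ i, s i) ≤ H := by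
  have hcl : IsClosed {x | φ x ≤ H} := isClosed_le hcont continuous_const
  have h1 : sSup (range s) ∈ closure (range s) := csSup_mem_closure (range_nonempty s) hb
  have h2 : range s ⊆ {x | φ x ≤ H} := by rintro _ ⟨i, rfl⟩; exact h i
  exact closure_minimal h2 hcl h1

/-- Bad rational test values. -/
noncomputable def badF {T : Type*} (φ : ℝ → ℝ) (u₀ : T → ℝ) (q : ℕ → ℝ) (α : ℝ) (k : ℕ) (t : T) :
    ℝ≥0∞ :=
  open Classical in
  ⨆ j : ℕ, if j ≤ k ∧ φ (q j - u₀ t) < α * φ (q j) then ENNReal.ofReal (φ (q j)) else 0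

lemma aux_badset {T : Type*} [MeasurableSpace T] (φ : ℝ → ℝ) (hcont : Continuous φ)
    (u₀ : T → ℝ) (hu : Measurable u₀) (α x : ℝ) :
    MeasurableSet {t | φ (x - u₀ t) < α * φ x} :=
  measurableSet_lt (hcont.measurable.comp (measurable_const.sub hu)) measurable_const

lemma badF_meas {T : Type*} [MeasurableSpace T] (φ : ℝ → ℝ) (hcont : Continuous φ)
    (u₀ : T → ℝ) (hu : Measurable u₀) (q : ℕ → ℝ) (α : ℝ) (k : ℕ) :
    Measurable (badF φ u₀ q α k) := by
  unfold badF
  refine Measurable.iSup fun j => ?_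
  refine Measurable.ite ?_ measurable_const measurable_const
  exact (MeasurableSet.const (j ≤ k)).inter (aux_badset φ hcont u₀ hu α (q j))

lemma badF_le {T : Type*} (φ : ℝ → ℝ) (u₀ : T → ℝ) (q : ℕ → ℝ) (α : ℝ) (k : ℕ) (t : T) :
    badF φ u₀ q α k t ≤ ∑ j ∈ Finset.range (k + 1), ENNReal.ofReal (φ (q j)) := by
  unfold badF
  refine iSup_le fun j => ?_
  split_ifs with h
  · exact Finset.single_le_sum (f := fun j => ENNReal.ofReal (φ (q j))) (fun _ _ => zero_le)
      (Finset.mem_range.2 (by omega))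
  · exact zero_le

lemma le_badF {T : Type*} (φ : ℝ → ℝ) (u₀ : T → ℝ) (q : ℕ → ℝ) (α : ℝ) (k : ℕ) (t : T) (j : ℕ)
    (hj : j ≤ k) (h : φ (q j - u₀ t) < α * φ (q j)) :
    ENNReal.ofReal (φ (q j)) ≤ badF φ u₀ q α k t := by
  unfold badF
  refine le_trans ?_ (le_iSup _ j)
  rw [if_pos ⟨hj, h⟩]

lemma badF_mono {T : Type*} (φ : ℝ → ℝ) (u₀ : T → ℝ) (q : ℕ → ℝ) (α : ℝ) :
    Monotone (badF φ u₀ q α) := by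
  intro k l hkl t
  conv_lhs => unfold badF
  refine iSup_le fun j => ?_
  split_ifs with h
  · exact le_badF φ u₀ q α l t j (h.1.trans hkl) h.2
  · exact zero_le

/-- The easy case: the supremum of bad values is integrable, hence gives the function `c`. -/
lemma aux_good {T : Type*} [MeasurableSpace T] (μ : Measure T)
    (φ : ℝ → ℝ) (hcont : Continuous φ) (hmono : Monotone φ) (hnonneg : ∀ u, 0 ≤ φ u)
    (htop : Tendsto φ atTop atTop)
    (u₀ : T → ℝ) (hu : Measurable u₀) (q : ℕ → ℝ) (hq : ∀ x y : ℝ, x < y → ∃ j, x < q j ∧ q j < y)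
    (α : ℝ) (hfin : ∫⁻ t, ⨆ k, badF φ u₀ q α k t ∂μ < ⊤) :
    ∃ c : T → EReal, Measurable c ∧ (∀ t, c t ≠ ⊤) ∧
        (∫⁻ t, phiE φ (c t) ∂μ < ⊤) ∧
        (∀ᵐ t ∂μ, ∀ u : ℝ, c t ≤ (u : EReal) → α * φ u ≤ φ (u - u₀ t)) := by
  classical
  let c₀ : T → EReal := fun t =>
    ⨆ j : ℕ, if φ (q j - u₀ t) < α * φ (q j) then ((q j : ℝ) : EReal) else ⊥
  have hc₀ : Measurable c₀ := Measurable.iSup fun j =>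
    Measurable.ite (aux_badset φ hcont u₀ hu α (q j)) measurable_const measurable_const
  have hG : Measurable (fun t => ⨆ k, badF φ u₀ q α k t) :=
    Measurable.iSup fun k => badF_meas φ hcont u₀ hu q α k
  -- values below `c₀` are controlled by `G`
  have hbelow : ∀ t, ∀ v : ℝ, (v : EReal) < c₀ t →
      ENNReal.ofReal (φ v) ≤ ⨆ k, badF φ u₀ q α k t := by
    intro t v hv
    obtain ⟨j, hj⟩ := lt_iSup_iff.1 hv
    split_ifs at hj with h
    · have hj' : v < q j := by exact_mod_cast hj
      calc ENNReal.ofReal (φ v) ≤ ENNReal.ofReal (φ (q j)) :=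
            ENNReal.ofReal_le_ofReal (hmono hj'.le)
        _ ≤ badF φ u₀ q α j t := le_badF φ u₀ q α j t j le_rfl h
        _ ≤ _ := le_iSup (fun k => badF φ u₀ q α k t) j
    · exact absurd hj not_lt_bot
  have hGfin := ae_lt_top hG hfin.ne
  have hc₀top : ∀ᵐ t ∂μ, c₀ t ≠ ⊤ := by
    filter_upwards [hGfin] with t ht h
    obtain ⟨v, hv⟩ := (htop.eventually_gt_atTop (⨆ k, badF φ u₀ q α k t).toReal).exists
    have h1 := hbelow t v (by rw [h]; exact EReal.coe_lt_top v)
    have h2 := (ENNReal.ofReal_le_iff_le_toReal ht.ne).1 h1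
    linarith
  refine ⟨fun t => if c₀ t = ⊤ then ⊥ else c₀ t,
    Measurable.ite (hc₀ (measurableSet_singleton ⊤)) measurable_const hc₀, ?_, ?_, ?_⟩
  · intro t
    dsimp only
    split_ifs with h
    · simp
    · exact h
  · refine lt_of_le_of_lt (lintegral_mono_ae ?_) hfin
    filter_upwards [hc₀top, hGfin] with t ht htf
    rw [if_neg ht]
    unfold phiE
    split_ifs with h
    · exact zero_le
    · rw [ENNReal.ofReal_le_iff_le_toReal htf.ne]
      have hcl : IsClosed {x | φ x ≤ (⨆ k, badF φ u₀ q α k t).toReal} :=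
        isClosed_le hcont continuous_const
      have hsub : Iio (c₀ t).toReal ⊆ {x | φ x ≤ (⨆ k, badF φ u₀ q α k t).toReal} := by
        intro v hv
        refine (ENNReal.ofReal_le_iff_le_toReal htf.ne).1 (hbelow t v ?_)
        rw [← EReal.coe_toReal ht h]
        exact_mod_cast hv
      have := closure_minimal hsub hcl
      rw [closure_Iio] at this
      exact this (mem_Iic.2 le_rfl)
  · filter_upwards [hc₀top] with t ht u hcu
    rw [if_neg ht] at hcu
    by_contra hlt
    push Not at hlt
    have hop : IsOpen {x | φ (x - u₀ t) < α * φ x} :=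
      isOpen_lt (by fun_prop) (by fun_prop)
    obtain ⟨ε, hε, hball⟩ := Metric.isOpen_iff.1 hop u hlt
    obtain ⟨j, hj1, hj2⟩ := hq u (u + ε) (by linarith)
    have hjb : φ (q j - u₀ t) < α * φ (q j) := by
      apply hball
      rw [Metric.mem_ball, Real.dist_eq, abs_lt]
      constructor <;> linarith
    have : ((q j : ℝ) : EReal) ≤ c₀ t := by
      refine le_trans ?_ (le_iSup _ j)
      rw [if_pos hjb]
    have h3 := this.trans hcu
    have h4 : q j ≤ u := by exact_mod_cast h3
    linarith

/-- The hard case: otherwise condition (C) fails. -/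
lemma aux_bad {T : Type*} [MeasurableSpace T] (μ : Measure T) [SigmaFinite μ]
    (hna : ∀ A : Set T, MeasurableSet A → 0 < μ A →
      ∃ B ⊆ A, MeasurableSet B ∧ 0 < μ B ∧ μ B < μ A)
    (φ : ℝ → ℝ) (hcont : Continuous φ) (hmono : Monotone φ) (hnonneg : ∀ u, 0 ≤ φ u)
    (hbot : Tendsto φ atBot (nhds 0)) (htop : Tendsto φ atTop atTop)
    (u₀ : T → ℝ) (hu : Measurable u₀) (q : ℕ → ℝ)
    (hinf : ∀ n : ℕ, ∫⁻ t, ⨆ k, badF φ u₀ q ((1 / 4) ^ (n + 1)) k t ∂μ = ⊤) :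
    ∃ c : T → ℝ, Measurable c ∧ (∫⁻ t, ENNReal.ofReal (φ (c t)) ∂μ < ⊤) ∧
      ∫⁻ t, ENNReal.ofReal (φ (c t + 1 * u₀ t)) ∂μ = ⊤ := by
  classical
  obtain ⟨b, hb, hbi⟩ := aux_base μ φ hbot
  have hstep : ∀ n : ℕ, ∃ k : ℕ, ∃ B, MeasurableSet B ∧
      2 ^ n ≤ ∫⁻ t in B, badF φ u₀ q ((1 / 4) ^ (n + 1)) k t ∂μ ∧
      ∫⁻ t in B, badF φ u₀ q ((1 / 4) ^ (n + 1)) k t ∂μ ≤ 2 * 2 ^ n := by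
    intro n
    have h := hinf n
    rw [lintegral_iSup (fun k => badF_meas φ hcont u₀ hu q _ k) (badF_mono φ u₀ q _)] at h
    have h2 : (2 ^ n : ℝ≥0∞) < ⨆ k, ∫⁻ t, badF φ u₀ q ((1 / 4) ^ (n + 1)) k t ∂μ := by
      rw [h]; exact (ENNReal.pow_ne_top (by simp)).lt_top
    obtain ⟨k, hk⟩ := lt_iSup_iff.1 h2
    exact ⟨k, aux_restrict μ hna _ (badF_meas φ hcont u₀ hu q _ k) _
      (by simp) (badF_le φ u₀ q _ k) (2 ^ n) (by positivity)
      (ENNReal.pow_ne_top (by simp)) hk.le⟩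
  choose k B hB hBlo hBhi using hstep
  let F : ℕ → T → ℝ≥0∞ := fun n => badF φ u₀ q ((1 / 4) ^ (n + 1)) (k n)
  have hF : ∀ n, Measurable (F n) := fun n => badF_meas φ hcont u₀ hu q _ (k n)
  let bad : ℕ × ℕ → T → Prop := fun i t =>
    t ∈ B i.1 ∧ i.2 ≤ k i.1 ∧ φ (q i.2 - u₀ t) < (1 / 4) ^ (i.1 + 1) * φ (q i.2)
  let s : ℕ × ℕ → T → ℝ := fun i t => if bad i t then max (q i.2 - u₀ t) (b t) else b t
  have hs : ∀ i, Measurable (s i) := by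
    intro i
    refine Measurable.ite ?_ ((measurable_const.sub hu).max hb) hb
    exact (hB i.1).inter ((MeasurableSet.const _).inter (aux_badset φ hcont u₀ hu _ _))
  let H : T → ℝ≥0∞ := fun t => ENNReal.ofReal (φ (b t)) +
    ∑' n : ℕ, (B n).indicator (fun t => ENNReal.ofReal ((1 / 4) ^ (n + 1)) * F n t) t
  have hHm : Measurable H := by
    refine (hcont.measurable.comp hb).ennreal_ofReal.add ?_
    exact Measurable.ennreal_tsum fun n => (measurable_const.mul (hF n)).indicator (hB n)
  have hHi : ∫⁻ t, H t ∂μ < ⊤ := by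
    change ∫⁻ t, (ENNReal.ofReal (φ (b t)) +
      ∑' n : ℕ, (B n).indicator (fun t => ENNReal.ofReal ((1 / 4) ^ (n + 1)) * F n t) t) ∂μ < ⊤
    have hbm : Measurable fun t => ENNReal.ofReal (φ (b t)) :=
      (hcont.measurable.comp hb).ennreal_ofReal
    rw [lintegral_add_left hbm,
      lintegral_tsum fun n => (((hF n).const_mul _).indicator (hB n)).aemeasurable]
    refine ENNReal.add_lt_top.2 ⟨hbi, ?_⟩
    have hterm : ∀ n, ∫⁻ t, (B n).indicator
        (fun t => ENNReal.ofReal ((1 / 4) ^ (n + 1)) * F n t) t ∂μ ≤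
        ENNReal.ofReal ((1 / 2) ^ (n + 1)) := by
      intro n
      rw [lintegral_indicator (hB n), lintegral_const_mul _ (hF n)]
      calc ENNReal.ofReal ((1 / 4) ^ (n + 1)) * ∫⁻ t in B n, F n t ∂μ
          ≤ ENNReal.ofReal ((1 / 4) ^ (n + 1)) * (2 * 2 ^ n) := by gcongr; exact hBhi n
        _ = ENNReal.ofReal ((1 / 4) ^ (n + 1)) * ENNReal.ofReal (2 ^ (n + 1)) := by
            rw [ENNReal.ofReal_pow (by norm_num : (0 : ℝ) ≤ 2)]
            simp [pow_succ, mul_comm]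
        _ = ENNReal.ofReal ((1 / 2) ^ (n + 1)) := by
            rw [← ENNReal.ofReal_mul (by positivity), ← mul_pow]
            norm_num
    refine lt_of_le_of_lt (ENNReal.tsum_le_tsum hterm) ?_
    have hsum : Summable (fun n : ℕ => ((1 / 2 : ℝ)) ^ (n + 1)) :=
      (summable_nat_add_iff 1).2 summable_geometric_two
    exact hsum.tsum_ofReal_lt_top
  have hHfin := ae_lt_top hHm hHi.ne
  have hsH : ∀ i t, ENNReal.ofReal (φ (s i t)) ≤ H t := by
    intro i t
    have hbH : ENNReal.ofReal (φ (b t)) ≤ H t := le_self_add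
    by_cases h : bad i t
    · have hst : s i t = max (q i.2 - u₀ t) (b t) := if_pos h
      rw [hst]
      rcases max_choice (q i.2 - u₀ t) (b t) with hm | hm
      · rw [hm]
        calc ENNReal.ofReal (φ (q i.2 - u₀ t))
            ≤ ENNReal.ofReal ((1 / 4) ^ (i.1 + 1) * φ (q i.2)) :=
              ENNReal.ofReal_le_ofReal h.2.2.le
          _ = ENNReal.ofReal ((1 / 4) ^ (i.1 + 1)) * ENNReal.ofReal (φ (q i.2)) :=
              ENNReal.ofReal_mul (by positivity)
          _ ≤ ENNReal.ofReal ((1 / 4) ^ (i.1 + 1)) * F i.1 t := by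
              gcongr
              exact le_badF φ u₀ q _ _ t i.2 h.2.1 h.2.2
          _ = (B i.1).indicator
              (fun t => ENNReal.ofReal ((1 / 4) ^ (i.1 + 1)) * F i.1 t) t := by
              rw [indicator_of_mem h.1]
          _ ≤ ∑' n : ℕ, (B n).indicator
              (fun t => ENNReal.ofReal ((1 / 4) ^ (n + 1)) * F n t) t :=
              ENNReal.le_tsum (f := fun n => (B n).indicator
                (fun t => ENNReal.ofReal ((1 / 4) ^ (n + 1)) * F n t) t) i.1
          _ ≤ H t := le_add_self
      · rw [hm]; exact hbH
    · have hst : s i t = b t := if_neg h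
      rw [hst]; exact hbH
  have hbdd : ∀ᵐ t ∂μ, BddAbove (range fun i => s i t) := by
    filter_upwards [hHfin] with t ht
    obtain ⟨v, hv⟩ := (htop.eventually_gt_atTop (H t).toReal).exists
    refine ⟨v, ?_⟩
    rintro _ ⟨i, rfl⟩
    have h1 := (ENNReal.ofReal_le_iff_le_toReal ht.ne).1 (hsH i t)
    by_contra hlt
    push Not at hlt
    have := hmono hlt.le
    linarith
  refine ⟨fun t => ⨆ i, s i t, Measurable.iSup hs, ?_, ?_⟩
  · refine lt_of_le_of_lt (lintegral_mono_ae ?_) hHi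
    filter_upwards [hHfin, hbdd] with t ht hbt
    rw [ENNReal.ofReal_le_iff_le_toReal ht.ne]
    exact aux_sup φ hcont _ hbt _ fun i => (ENNReal.ofReal_le_iff_le_toReal ht.ne).1 (hsH i t)
  · have hge : ∀ n : ℕ, (2 : ℝ≥0∞) ^ n ≤
        ∫⁻ t, ENNReal.ofReal (φ ((⨆ i, s i t) + 1 * u₀ t)) ∂μ := by
      intro n
      refine (hBlo n).trans ?_
      rw [← lintegral_indicator (hB n)]
      refine lintegral_mono_ae ?_
      filter_upwards [hbdd] with t hbt
      by_cases htB : t ∈ B n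
      · rw [indicator_of_mem htB]
        unfold badF
        refine iSup_le fun j => ?_
        split_ifs with h
        · apply ENNReal.ofReal_le_ofReal
          apply hmono
          have h1 : s (n, j) t = max (q j - u₀ t) (b t) := if_pos ⟨htB, h.1, h.2⟩
          have h2 : s (n, j) t ≤ ⨆ i, s i t := le_ciSup hbt (n, j)
          have h3 : q j - u₀ t ≤ s (n, j) t := by rw [h1]; exact le_max_left _ _
          linarith
        · exact zero_le
      · rw [indicator_of_notMem htB]
        exact zero_le
    refine top_le_iff.1 (le_of_tendsto' (ENNReal.tendsto_pow_atTop_nhds_top_iff.2 ?_) hge)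
    norm_num

/-- For a non-atomic σ-finite measure `μ`, a deformed exponential `φ` and a
measurable positive `u₀` satisfy condition (C) iff for some `α ∈ (0,1)` there is a
measurable `c : T → ℝ ∪ {−∞}` with `∫ φ(c) dμ < ∞` (convention `φ(−∞) = 0`) such that
for μ-a.e. `t`, `α φ(u) ≤ φ(u − u₀(t))` for all real `u ≥ c(t)`. -/
theorem condC_iff_ineq
    {T : Type*} [MeasurableSpace T] (μ : Measure T) [SigmaFinite μ]
    (hna : ∀ A : Set T, MeasurableSet A → 0 < μ A →
      ∃ B ⊆ A, MeasurableSet B ∧ 0 < μ B ∧ μ B < μ A)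
    (φ : ℝ → ℝ) (hconv : ConvexOn ℝ Set.univ φ) (hnonneg : ∀ u, 0 ≤ φ u)
    (hbot : Tendsto φ atBot (nhds 0)) (htop : Tendsto φ atTop atTop)
    (u₀ : T → ℝ) (hu₀meas : Measurable u₀) (hu₀pos : ∀ t, 0 < u₀ t) :
    (∀ c : T → ℝ, Measurable c →
      (∫⁻ t, ENNReal.ofReal (φ (c t)) ∂μ < ⊤) →
      ∀ lam : ℝ, 0 < lam → ∫⁻ t, ENNReal.ofReal (φ (c t + lam * u₀ t)) ∂μ < ⊤) ↔
    (∃ α : ℝ, α ∈ Set.Ioo (0 : ℝ) 1 ∧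
      ∃ c : T → EReal, Measurable c ∧ (∀ t, c t ≠ ⊤) ∧
        (∫⁻ t, phiE φ (c t) ∂μ < ⊤) ∧
        (∀ᵐ t ∂μ, ∀ u : ℝ, c t ≤ (u : EReal) → α * φ u ≤ φ (u - u₀ t))) := by
  have hcont : Continuous φ := hconv.locallyLipschitz.continuous
  have hmono : Monotone φ := aux_mono φ hconv hnonneg hbot
  constructor
  · intro hC
    obtain ⟨q, hq⟩ : ∃ q : ℕ → ℝ, ∀ x y : ℝ, x < y → ∃ j, x < q j ∧ q j < y := by
      refine ⟨fun j => (((Denumerable.eqv ℚ).symm j : ℚ) : ℝ), fun x y hxy => ?_⟩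
      obtain ⟨r, h1, h2⟩ := exists_rat_btwn hxy
      exact ⟨Denumerable.eqv ℚ r, by simpa using h1, by simpa using h2⟩
    by_cases hfin : ∃ n : ℕ, ∫⁻ t, ⨆ k, badF φ u₀ q ((1 / 4) ^ (n + 1)) k t ∂μ < ⊤
    · obtain ⟨n, hn⟩ := hfin
      refine ⟨(1 / 4) ^ (n + 1), ⟨by positivity, ?_⟩, ?_⟩
      · exact pow_lt_one₀ (by norm_num) (by norm_num) (by omega)
      · exact aux_good μ φ hcont hmono hnonneg htop u₀ hu₀meas q hq _ hn
    · exfalso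
      have hinf : ∀ n : ℕ, ∫⁻ t, ⨆ k, badF φ u₀ q ((1 / 4) ^ (n + 1)) k t ∂μ = ⊤ := by
        intro n
        by_contra h
        exact hfin ⟨n, lt_top_iff_ne_top.2 h⟩
      obtain ⟨c, hc, hci, hct⟩ := aux_bad μ hna φ hcont hmono hnonneg hbot htop u₀ hu₀meas q hinf
      exact (hC c hc hci 1 one_pos).ne hct
  · rintro ⟨α, ⟨hα0, hα1⟩, c, hc, hctop, hci, hineq⟩
    have hstep : ∀ d : T → ℝ, Measurable d → ∫⁻ t, ENNReal.ofReal (φ (d t)) ∂μ < ⊤ →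
        ∫⁻ t, ENNReal.ofReal (φ (d t + u₀ t)) ∂μ < ⊤ := by
      intro d hd hdi
      have hm : Measurable fun t => ENNReal.ofReal (φ (d t)) :=
        (hcont.measurable.comp hd).ennreal_ofReal
      have hle : ∫⁻ t, ENNReal.ofReal (φ (d t + u₀ t)) ∂μ ≤
          ∫⁻ t, (ENNReal.ofReal α⁻¹ * ENNReal.ofReal (φ (d t)) + phiE φ (c t)) ∂μ := by
        refine lintegral_mono_ae ?_
        filter_upwards [hineq] with t ht
        rcases le_or_gt (c t) ((d t + u₀ t : ℝ) : EReal) with h | h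
        · refine le_trans ?_ le_self_add
          rw [← ENNReal.ofReal_mul (by positivity)]
          apply ENNReal.ofReal_le_ofReal
          have := ht _ h
          rw [add_sub_cancel_right] at this
          rw [inv_mul_eq_div, le_div_iff₀ hα0]
          linarith
        · refine le_trans ?_ le_add_self
          have hnb : c t ≠ ⊥ := (bot_le.trans_lt h).ne'
          unfold phiE
          rw [if_neg hnb]
          apply ENNReal.ofReal_le_ofReal
          apply hmono
          rw [← EReal.coe_toReal (hctop t) hnb] at h
          exact le_of_lt (by exact_mod_cast h)
      refine hle.trans_lt ?_
      rw [lintegral_add_left (hm.const_mul _), lintegral_const_mul _ hm]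
      exact ENNReal.add_lt_top.2 ⟨ENNReal.mul_lt_top ENNReal.ofReal_lt_top hdi, hci⟩
    intro d hd hdi lam hlam
    have hn : ∀ n : ℕ, ∫⁻ t, ENNReal.ofReal (φ (d t + n * u₀ t)) ∂μ < ⊤ := by
      intro n
      induction n with
      | zero => simpa using hdi
      | succ n ih =>
        have := hstep (fun t => d t + n * u₀ t) (hd.add (hu₀meas.const_mul _)) ih
        have he : ∀ t, d t + ((n + 1 : ℕ) : ℝ) * u₀ t = d t + n * u₀ t + u₀ t := by
          intro t; push_cast; ring
        simp only [he]
        exact this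
    obtain ⟨n, hnl⟩ := exists_nat_ge lam
    refine lt_of_le_of_lt (lintegral_mono fun t => ?_) (hn n)
    apply ENNReal.ofReal_le_ofReal
    apply hmono
    have := mul_le_mul_of_nonneg_right hnl (hu₀pos t).le
    linarith
end

section
/- Let φ be a deformed exponential and suppose there exist λ₀ > 0, K ≥ 1, and c ∈ ℝ ∪ {−∞} such that φ(u) ≤ K·φ(u − λ₀) for all real u ≥ c. Set λ = log(K)/λ₀. Then for every v ≥ 0 and every u ≥ c one has φ(u + v) ≤ K·φ(u)·e^{λv}; in particular, φ cannot increase faster than u ↦ e^{λu}. -/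
open Filter Set

/-- Let `φ` be a deformed exponential and suppose there are `λ₀ > 0`, `K ≥ 1`
and `c ∈ ℝ ∪ {−∞}` with `φ(u) ≤ K φ(u − λ₀)` for all real `u ≥ c`. With `λ = log K / λ₀`,
for every `v ≥ 0` and every `u ≥ c` one has `φ(u + v) ≤ K φ(u) e^{λ v}`. -/
theorem growth_bound_of_ratio_bound
    (φ : ℝ → ℝ) (hconv : ConvexOn ℝ Set.univ φ) (hnonneg : ∀ u, 0 ≤ φ u)
    (hbot : Tendsto φ atBot (nhds 0)) (htop : Tendsto φ atTop atTop)
    (lam₀ : ℝ) (hlam₀ : 0 < lam₀) (K : ℝ) (hK : 1 ≤ K)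
    (c : EReal) (hc : c ≠ ⊤)
    (hratio : ∀ u : ℝ, c ≤ (u : EReal) → φ u ≤ K * φ (u - lam₀))
    (lam : ℝ) (hlam : lam = Real.log K / lam₀) :
    ∀ v : ℝ, 0 ≤ v → ∀ u : ℝ, c ≤ (u : EReal) →
      φ (u + v) ≤ K * φ u * Real.exp (lam * v) := by
  have hmono : ∀ x y : ℝ, x ≤ y → φ x ≤ φ y := by
    intro x y hxy
    by_contra! hlt
    have h1 : ∀ᶠ z in atBot, φ x ≤ φ z := by
      filter_upwards [eventually_le_atBot x] with z hz
      have h2 : φ x ≤ max (φ z) (φ y) :=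
        hconv.le_max_of_mem_Icc (mem_univ z) (mem_univ y) ⟨hz, hxy⟩
      rcases le_max_iff.mp h2 with h | h
      · exact h
      · linarith
    have h3 : φ x ≤ 0 := ge_of_tendsto hbot h1
    linarith [hnonneg y]
  have hK0 : 0 < K := by linarith
  have hiter : ∀ (n : ℕ) (u : ℝ), c ≤ (u : EReal) → φ (u + n * lam₀) ≤ K ^ n * φ u := by
    intro n u hu
    induction n with
    | zero => simp
    | succ n ih =>
      have hle : u ≤ u + ((n + 1 : ℕ) : ℝ) * lam₀ := by
        have : 0 ≤ ((n + 1 : ℕ) : ℝ) * lam₀ := by positivity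
        linarith
      have h1 := hratio (u + ((n + 1 : ℕ) : ℝ) * lam₀)
        (hu.trans (EReal.coe_le_coe_iff.mpr hle))
      have h2 : u + ((n + 1 : ℕ) : ℝ) * lam₀ - lam₀ = u + n * lam₀ := by
        push_cast; ring
      rw [h2] at h1
      calc _ ≤ K * φ (u + n * lam₀) := h1
        _ ≤ K * (K ^ n * φ u) := by gcongr
        _ = _ := by ring
  intro v hv u hu
  have hv' : 0 ≤ v / lam₀ := by positivity
  have hn1 := Nat.floor_le hv'
  have hn2 := (Nat.lt_floor_add_one (v / lam₀)).le
  set n := ⌊v / lam₀⌋₊ with hn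
  have hvle : v ≤ ((n + 1 : ℕ) : ℝ) * lam₀ := by
    push_cast
    exact (div_le_iff₀ hlam₀).mp hn2
  have hpow : K ^ n ≤ Real.exp (lam * v) := by
    have h1 : K ^ n = Real.exp (n * Real.log K) := by
      rw [Real.exp_nat_mul, Real.exp_log hK0]
    have h2 : lam * v = v / lam₀ * Real.log K := by
      rw [hlam]; ring
    rw [h1, h2]
    exact Real.exp_le_exp.mpr (mul_le_mul_of_nonneg_right hn1 (Real.log_nonneg hK))
  calc φ (u + v) ≤ φ (u + ((n + 1 : ℕ) : ℝ) * lam₀) := hmono _ _ (by linarith)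
    _ ≤ K ^ (n + 1) * φ u := hiter (n + 1) u hu
    _ = K * φ u * K ^ n := by ring
    _ ≤ K * φ u * Real.exp (lam * v) :=
      mul_le_mul_of_nonneg_left hpow (mul_nonneg hK0.le (hnonneg u))
end

section
/- Let κ ∈ [−1,1] with κ ≠ 0. For every α ∈ (0,1) there exists λ > 0 such that λ ≤ log_κ(v) − log_κ(αv) for all v > 0; equivalently, α·exp_κ(u) ≤ exp_κ(u − λ) for all u ∈ ℝ. -/
open Filter Set

/-- For `κ ∈ [−1,1]`, `κ ≠ 0`, and every `α ∈ (0,1)` there exists `λ > 0`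
such that `λ ≤ log_κ(v) − log_κ(α v)` for all `v > 0`; equivalently,
`α exp_κ(u) ≤ exp_κ(u − λ)` for all `u ∈ ℝ`. -/
theorem kappa_exp_shift_bound
    (κ : ℝ) (hκ : κ ∈ Set.Icc (-1 : ℝ) 1) (hκ0 : κ ≠ 0)
    (expk : ℝ → ℝ) (hexpk : ∀ u : ℝ,
      expk u = (κ * u + Real.sqrt (1 + κ ^ 2 * u ^ 2)) ^ (1 / κ))
    (logk : ℝ → ℝ) (hlogk : ∀ v : ℝ, logk v = (v ^ κ - v ^ (-κ)) / (2 * κ))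
    (α : ℝ) (hα : α ∈ Set.Ioo (0 : ℝ) 1) :
    ∃ lam : ℝ, 0 < lam ∧
      (∀ v : ℝ, 0 < v → lam ≤ logk v - logk (α * v)) ∧
      (∀ u : ℝ, α * expk u ≤ expk (u - lam)) := by
  obtain ⟨h0, h1⟩ := hα
  have ha : Real.log α < 0 := Real.log_neg h0 h1
  have hS := Real.sinh_sub_id_strictMono.monotone
  have hL : ∀ v : ℝ, 0 < v → logk v = Real.sinh (κ * Real.log v) / κ := by
    intro v hv
    rw [hlogk, Real.rpow_def_of_pos hv, Real.rpow_def_of_pos hv, Real.sinh_eq]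
    rw [show Real.log v * κ = κ * Real.log v by ring,
      show Real.log v * -κ = -(κ * Real.log v) by ring]
    field_simp
  have hE : ∀ u : ℝ, expk u = Real.exp (Real.arsinh (κ * u) / κ) := by
    intro u
    rw [hexpk, show κ ^ 2 * u ^ 2 = (κ * u) ^ 2 by ring, ← Real.exp_arsinh, ← Real.exp_mul]
    congr 1
    ring
  refine ⟨-Real.log α, by linarith, ?_, ?_⟩
  · intro v hv
    rw [hL v hv, hL _ (mul_pos h0 hv), Real.log_mul h0.ne' hv.ne', ← sub_div]
    rcases lt_or_gt_of_ne hκ0 with hk | hk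
    · rw [le_div_iff_of_neg hk]
      have := hS (show κ * Real.log v ≤ κ * (Real.log α + Real.log v) by nlinarith)
      simp only at this
      linarith
    · rw [le_div_iff₀ hk]
      have := hS (show κ * (Real.log α + Real.log v) ≤ κ * Real.log v by nlinarith)
      simp only at this
      linarith
  · intro u
    rw [hE, hE]
    nth_rewrite 1 [← Real.exp_log h0]
    rw [← Real.exp_add, Real.exp_le_exp, ← le_sub_iff_add_le, ← sub_div]
    rcases lt_or_gt_of_ne hκ0 with hk | hk
    · rw [le_div_iff_of_neg hk]
      have := hS (Real.arsinh_le_arsinh.2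
        (show κ * u ≤ κ * (u - -Real.log α) by nlinarith))
      simp only [Real.sinh_arsinh] at this
      linarith
    · rw [le_div_iff₀ hk]
      have := hS (Real.arsinh_le_arsinh.2
        (show κ * (u - -Real.log α) ≤ κ * u by nlinarith))
      simp only [Real.sinh_arsinh] at this
      linarith
end

section
/- Let κ ∈ [−1,1] with κ ≠ 0. Then there exists β ∈ (0,1) such that β·exp_κ(u) ≤ exp_κ(u − 1) for all u ∈ ℝ. Consequently, for any σ-finite measure μ, the κ-exponential exp_κ together with the constant function u₀ ≡ 1 satisfies condition (C). -/
open MeasureTheory Filter Set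

lemma arsinh_lip (a b : ℝ) : |Real.arsinh a - Real.arsinh b| ≤ |a - b| := by
  have h := Convex.norm_image_sub_le_of_norm_hasDerivWithin_le (f := Real.arsinh)
    (f' := fun x => (Real.sqrt (1 + x ^ 2))⁻¹) (C := 1) (s := Set.univ) (x := b) (y := a)
    (fun x _ => (Real.hasDerivAt_arsinh x).hasDerivWithinAt)
    (fun x _ => by
      have h1 : 1 ≤ Real.sqrt (1 + x ^ 2) := by
        rw [Real.one_le_sqrt]
        nlinarith [sq_nonneg x]
      rw [Real.norm_of_nonneg (by positivity)]
      exact inv_le_one_of_one_le₀ h1)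
    convex_univ (Set.mem_univ _) (Set.mem_univ _)
  simpa [Real.norm_eq_abs] using h

lemma expk_aux (κ : ℝ) (hκ0 : κ ≠ 0)
    (expk : ℝ → ℝ) (hexpk : ∀ u : ℝ,
      expk u = (κ * u + Real.sqrt (1 + κ ^ 2 * u ^ 2)) ^ (1 / κ)) (u l : ℝ) (hl : 0 < l) :
    expk (u + l) ≤ Real.exp l * expk u := by
  have key : ∀ v, expk v = Real.exp (Real.arsinh (κ * v) / κ) := by
    intro v
    rw [hexpk, ← mul_pow, ← Real.exp_arsinh, ← Real.exp_mul]
    congr 1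
    ring
  rw [key, key, ← Real.exp_add, Real.exp_le_exp]
  have h := arsinh_lip (κ * (u + l)) (κ * u)
  have h2 : |(Real.arsinh (κ * (u + l)) - Real.arsinh (κ * u)) / κ| ≤ l := by
    rw [abs_div, div_le_iff₀ (abs_pos.mpr hκ0)]
    refine h.trans (le_of_eq ?_)
    rw [← mul_sub, abs_mul, add_sub_cancel_left, abs_of_pos hl, mul_comm]
  have h3 := (le_abs_self _).trans h2
  rw [sub_div] at h3
  linarith

/-- For `κ ∈ [−1,1]`, `κ ≠ 0`, there exists `β ∈ (0,1)` with
`β exp_κ(u) ≤ exp_κ(u − 1)` for all `u ∈ ℝ`; consequently, for any σ-finite measure `μ`,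
the κ-exponential together with the constant function `u₀ ≡ 1` satisfies condition (C). -/
theorem kappa_exp_satisfies_condC
    {T : Type*} [MeasurableSpace T] (μ : Measure T) [SigmaFinite μ]
    (κ : ℝ) (hκ : κ ∈ Set.Icc (-1 : ℝ) 1) (hκ0 : κ ≠ 0)
    (expk : ℝ → ℝ) (hexpk : ∀ u : ℝ,
      expk u = (κ * u + Real.sqrt (1 + κ ^ 2 * u ^ 2)) ^ (1 / κ)) :
    (∃ β : ℝ, β ∈ Set.Ioo (0 : ℝ) 1 ∧ ∀ u : ℝ, β * expk u ≤ expk (u - 1)) ∧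
    (∀ c : T → ℝ, Measurable c →
      (∫⁻ t, ENNReal.ofReal (expk (c t)) ∂μ < ⊤) →
      ∀ lam : ℝ, 0 < lam →
        ∫⁻ t, ENNReal.ofReal (expk (c t + lam * 1)) ∂μ < ⊤) := by
  have key := expk_aux κ hκ0 expk hexpk
  refine ⟨⟨Real.exp (-1), ⟨Real.exp_pos _, by simp⟩, fun u => ?_⟩, ?_⟩
  · have h := key (u - 1) 1 one_pos
    rw [sub_add_cancel] at h
    have h2 := mul_le_mul_of_nonneg_left h (Real.exp_pos (-1)).le
    rwa [← mul_assoc, ← Real.exp_add, neg_add_cancel, Real.exp_zero, one_mul] at h2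
  · intro c _ hc l hl
    rw [mul_one]
    calc ∫⁻ t, ENNReal.ofReal (expk (c t + l)) ∂μ
        ≤ ∫⁻ t, ENNReal.ofReal (Real.exp l) * ENNReal.ofReal (expk (c t)) ∂μ := by
          refine lintegral_mono fun t => ?_
          rw [← ENNReal.ofReal_mul (Real.exp_pos l).le]
          exact ENNReal.ofReal_le_ofReal (key (c t) l hl)
      _ = ENNReal.ofReal (Real.exp l) * ∫⁻ t, ENNReal.ofReal (expk (c t)) ∂μ :=
          lintegral_const_mul' _ _ ENNReal.ofReal_ne_top
      _ < ⊤ := ENNReal.mul_lt_top ENNReal.ofReal_lt_top hc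
end

section
/- Define φ : ℝ → (0,∞) by φ(u) = e^{(u+1)²/2} for u ≥ 0 and φ(u) = e^{u + 1/2} for u ≤ 0. Then φ is a deformed exponential (convex, with limit 0 at −∞ and limit ∞ at ∞), and for every λ₀ > 0 one has limsup_{u→∞} φ(u)/φ(u − λ₀) = limsup_{u→∞} e^{uλ₀ − (λ₀² − λ₀)/2} = ∞. -/
open Filter Set

/-- The function `φ(u) = e^{(u+1)²/2}` for `u ≥ 0` and `φ(u) = e^{u + 1/2}`
for `u ≤ 0` is a deformed exponential (convex, limit `0` at `−∞` and `∞` at `∞`), and for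
every `λ₀ > 0` one has
`limsup_{u→∞} φ(u)/φ(u−λ₀) = limsup_{u→∞} e^{uλ₀ − (λ₀² − λ₀)/2} = ∞`. -/
theorem counterexample_deformed_exponential
    (φ : ℝ → ℝ)
    (hφ : ∀ u : ℝ, φ u = if 0 ≤ u then Real.exp ((u + 1) ^ 2 / 2)
      else Real.exp (u + 1 / 2)) :
    ConvexOn ℝ Set.univ φ ∧
    Tendsto φ atBot (nhds 0) ∧
    Tendsto φ atTop atTop ∧
    (∀ lam₀ : ℝ, 0 < lam₀ →
      Filter.limsup (fun u : ℝ => ENNReal.ofReal (φ u / φ (u - lam₀))) atTop =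
        Filter.limsup (fun u : ℝ =>
          ENNReal.ofReal (Real.exp (u * lam₀ - (lam₀ ^ 2 - lam₀) / 2))) atTop ∧
      Filter.limsup (fun u : ℝ => ENNReal.ofReal (φ u / φ (u - lam₀))) atTop = ⊤) := by
  have hg : ∀ u, φ u = Real.exp (u + 1 / 2 + (max u 0) ^ 2 / 2) := by
    intro u
    rw [hφ]
    split_ifs with h
    · rw [max_eq_left h]; congr 1; ring
    · rw [max_eq_right (not_le.mp h).le]; congr 1; ring
  have hm : ConvexOn ℝ Set.univ (fun u : ℝ => (max u 0) ^ 2) := by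
    have h1 : ConvexOn ℝ Set.univ (fun u : ℝ => max u 0) :=
      (convexOn_id convex_univ).sup (convexOn_const (0 : ℝ) convex_univ)
    exact h1.pow (fun x _ => le_max_right _ _) 2
  refine ⟨⟨convex_univ, ?_⟩, ?_, ?_, ?_⟩
  · intro x _ y _ a b ha hb hab
    have h1 := hm.2 (mem_univ x) (mem_univ y) ha hb hab
    have h2 := convexOn_exp.2 (mem_univ (x + 1 / 2 + (max x 0) ^ 2 / 2))
      (mem_univ (y + 1 / 2 + (max y 0) ^ 2 / 2)) ha hb hab
    rw [hg, hg x, hg y]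
    refine le_trans (Real.exp_le_exp.mpr ?_) h2
    simp only [smul_eq_mul] at h1 ⊢
    have : b = 1 - a := by linarith
    subst this
    linarith
  · have h : Tendsto (fun u : ℝ => Real.exp (u + 1 / 2)) atBot (nhds 0) :=
      Real.tendsto_exp_atBot.comp (tendsto_atBot_add_const_right _ _ tendsto_id)
    refine h.congr' ?_
    filter_upwards [eventually_lt_atBot (0 : ℝ)] with u hu
    rw [hφ, if_neg (not_le.mpr hu)]
  · refine tendsto_atTop_mono (fun u => ?_) Real.tendsto_exp_atTop
    rw [hg]
    apply Real.exp_le_exp.mpr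
    have := sq_nonneg (max u 0)
    linarith
  · intro l hl
    have key : ∀ c : ℝ, Tendsto (fun u : ℝ => ENNReal.ofReal (Real.exp (u * l - c)))
        atTop (nhds ⊤) := by
      intro c
      refine ENNReal.tendsto_ofReal_atTop.comp (Real.tendsto_exp_atTop.comp ?_)
      exact tendsto_atTop_add_const_right _ (-c) (tendsto_id.atTop_mul_const hl)
    have h1 : Tendsto (fun u : ℝ => ENNReal.ofReal (φ u / φ (u - l))) atTop (nhds ⊤) := by
      refine (key (l ^ 2 / 2 - l)).congr' ?_
      filter_upwards [eventually_ge_atTop (0 : ℝ), eventually_ge_atTop l] with u hu hul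
      rw [hφ, hφ, if_pos hu, if_pos (sub_nonneg.mpr hul), ← Real.exp_sub]
      congr 2
      ring
    exact ⟨h1.limsup_eq.trans (key _).limsup_eq.symm, h1.limsup_eq⟩
end

section
/- Let φ be a deformed exponential and {u_{0,i}}_{i≥1} a sequence of positive real numbers. Suppose there do NOT exist α ∈ (0,1), ε > 0, and a sequence {c_i} ⊂ ℝ ∪ {−∞} with Σ_{i=1}^∞ φ(c_i) < ∞ such that α·φ(u) ≤ φ(u − u_{0,i}) holds for all i and all u > c_i with φ(u − u_{0,i}) < ε. Then there exist a family of real numbers {c_{n,i}} and a sequence {A_n} of pairwise disjoint subsets of ℕ such that, for each n ≥ 1, 1/2 ≤ Σ_{i∈A_n} φ(c_{n,i}) and Σ_{i∈A_n} φ(c_{n,i} − u_{0,i}) ≤ 2^{−n}. -/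
open Filter Set

lemma crossing (f : ℕ → ℝ) (hf : ∀ i, 0 ≤ f i) (hs : ¬ Summable f) (N : ℕ) :
    ∃ F : Finset ℕ, (∀ i ∈ F, N ≤ i) ∧ 1 / 2 ≤ ∑ i ∈ F, f i ∧
      (∑ i ∈ F, f i ≤ 1 ∨ ∃ j, F = {j}) := by
  classical
  have hex : ∃ K, 1 / 2 ≤ ∑ i ∈ Finset.range K, f (N + i) := by
    have hs' : ¬ Summable (fun i => f (i + N)) := by
      rwa [summable_nat_add_iff]
    have ht := (not_summable_iff_tendsto_nat_atTop_of_nonneg (fun i => hf (i + N))).1 hs'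
    obtain ⟨K, hK⟩ := (ht.eventually_ge_atTop (1 / 2)).exists
    exact ⟨K, by simpa [add_comm] using hK⟩
  obtain ⟨K, hK, hmin⟩ : ∃ K, 1 / 2 ≤ ∑ i ∈ Finset.range K, f (N + i) ∧
      ∀ m < K, ¬ 1 / 2 ≤ ∑ i ∈ Finset.range m, f (N + i) :=
    ⟨Nat.find hex, Nat.find_spec hex, fun m hm => Nat.find_min hex hm⟩
  rcases K with _ | K
  · norm_num at hK
  by_cases hbig : 1 / 2 ≤ f (N + K)
  · exact ⟨{N + K}, by simp, by simpa using hbig, Or.inr ⟨_, rfl⟩⟩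
  · have h1 := hmin K (Nat.lt_succ_self K)
    have he : ∑ i ∈ (Finset.range (K + 1)).map (addLeftEmbedding N), f i
        = ∑ i ∈ Finset.range (K + 1), f (N + i) := by simp
    refine ⟨(Finset.range (K + 1)).map (addLeftEmbedding N), ?_, ?_, Or.inl ?_⟩
    · intro i hi
      simp only [Finset.mem_map, addLeftEmbedding_apply] at hi
      obtain ⟨a, -, rfl⟩ := hi
      omega
    · rw [he]; exact hK
    · rw [he, Finset.sum_range_succ]
      push Not at h1 hbig
      linarith

lemma step_exists
    (φ : ℝ → ℝ) (hcont : Continuous φ) (hnonneg : ∀ u, 0 ≤ φ u)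
    (htop : Tendsto φ atTop atTop)
    (u₀ : ℕ → ℝ)
    (hno : ¬ ∃ α : ℝ, α ∈ Set.Ioo (0 : ℝ) 1 ∧ ∃ ε : ℝ, 0 < ε ∧
      ∃ c : ℕ → EReal, (∀ i, c i ≠ ⊤) ∧ (∑' i, phiE φ (c i) < ⊤) ∧
        ∀ i : ℕ, ∀ u : ℝ, c i < (u : EReal) → φ (u - u₀ i) < ε →
          α * φ u ≤ φ (u - u₀ i)) (a : ℝ) (ha : a ∈ Set.Ioo (0 : ℝ) 1) (N : ℕ) :
    ∃ (F : Finset ℕ) (c : ℕ → ℝ), (∀ i ∈ F, N ≤ i) ∧ 1 / 2 ≤ ∑ i ∈ F, φ (c i) ∧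
      ∑ i ∈ F, φ (c i - u₀ i) ≤ a := by
  classical
  let B : ℕ → Set ℝ := fun i => {u | φ (u - u₀ i) < a ∧ φ (u - u₀ i) < a * φ u}
  have hbdd : ∀ i, BddAbove (B i) := by
    intro i
    obtain ⟨M, hM⟩ := (htop.eventually_ge_atTop a).exists_forall_of_atTop
    refine ⟨M + u₀ i, fun u hu => ?_⟩
    by_contra h
    push Not at h
    have h1 := hM (u - u₀ i) (by linarith)
    have h2 : φ (u - u₀ i) < a := hu.1
    linarith
  have hcl : ∀ i, (B i).Nonempty → φ (sSup (B i) - u₀ i) ≤ a ∧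
      φ (sSup (B i) - u₀ i) ≤ a * φ (sSup (B i)) := by
    intro i hi
    have hm : sSup (B i) ∈ closure (B i) := csSup_mem_closure hi (hbdd i)
    have hc : IsClosed {u | φ (u - u₀ i) ≤ a ∧ φ (u - u₀ i) ≤ a * φ u} := by
      have h1 : Continuous fun u => φ (u - u₀ i) := by fun_prop
      have h2 : Continuous fun u => a * φ u := by fun_prop
      exact (isClosed_le h1 continuous_const).inter (isClosed_le h1 h2)
    have hsub : B i ⊆ {u | φ (u - u₀ i) ≤ a ∧ φ (u - u₀ i) ≤ a * φ u} :=
      fun u hu => ⟨hu.1.le, hu.2.le⟩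
    exact closure_minimal hsub hc hm
  let c' : ℕ → EReal := fun i => if (B i).Nonempty then ((sSup (B i) : ℝ) : EReal) else ⊥
  let f : ℕ → ℝ := fun i => if (B i).Nonempty then φ (sSup (B i)) else 0
  have hf : ∀ i, 0 ≤ f i := by
    intro i
    simp only [f]
    split_ifs
    · exact hnonneg _
    · exact le_rfl
  have hpf : ∀ i, phiE φ (c' i) = ENNReal.ofReal (f i) := by
    intro i
    by_cases h : (B i).Nonempty <;> simp [phiE, c', f, h]
  have hns : ¬ Summable f := by
    intro hsum
    apply hno
    refine ⟨a, ha, a, ha.1, c', ?_, ?_, ?_⟩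
    · intro i
      by_cases h : (B i).Nonempty <;> simp [c', h]
    · simp only [hpf]
      exact hsum.tsum_ofReal_lt_top
    · intro i u hu hlt
      by_contra hcon
      push Not at hcon
      have hmem : u ∈ B i := ⟨hlt, hcon⟩
      have hne : (B i).Nonempty := ⟨u, hmem⟩
      simp only [c', hne, if_true] at hu
      have := EReal.coe_lt_coe_iff.1 hu
      exact absurd (le_csSup (hbdd i) hmem) (not_le.2 this)
  obtain ⟨F, hF1, hF2, hF3⟩ := crossing f hf hns N
  have hsumf : ∑ i ∈ F with (B i).Nonempty, φ (sSup (B i)) = ∑ i ∈ F, f i := by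
    rw [Finset.sum_filter]
  refine ⟨F.filter (fun i => (B i).Nonempty), fun i => sSup (B i), ?_, ?_, ?_⟩
  · intro i hi
    exact hF1 i (Finset.mem_filter.1 hi).1
  · rw [hsumf]; exact hF2
  · rcases hF3 with h | ⟨j, rfl⟩
    · calc ∑ i ∈ F with (B i).Nonempty, φ (sSup (B i) - u₀ i)
          ≤ ∑ i ∈ F with (B i).Nonempty, a * φ (sSup (B i)) :=
            Finset.sum_le_sum fun i hi => (hcl i (Finset.mem_filter.1 hi).2).2
        _ = a * ∑ i ∈ F, f i := by rw [← Finset.mul_sum, hsumf]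
        _ ≤ a * 1 := mul_le_mul_of_nonneg_left h ha.1.le
        _ = a := mul_one a
    · rw [Finset.sum_filter, Finset.sum_singleton]
      split_ifs with h
      · exact (hcl j h).1
      · exact ha.1.le

/-- Let `φ` be a deformed exponential and `{u_{0,i}}` positive reals.
If there exist no `α ∈ (0,1)`, `ε > 0` and sequence `{c_i} ⊂ ℝ ∪ {−∞}` with
`Σ φ(c_i) < ∞` such that `α φ(u) ≤ φ(u − u_{0,i})` for all `i` and all `u > c_i` with
`φ(u − u_{0,i}) < ε`, then there are reals `{c_{n,i}}` and pairwise disjoint subsets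
`{A_n}` of `ℕ` with `1/2 ≤ Σ_{i∈A_n} φ(c_{n,i})` and
`Σ_{i∈A_n} φ(c_{n,i} − u_{0,i}) ≤ 2^{−n}` for each `n ≥ 1`. -/
theorem technical_lemma_seq
    (φ : ℝ → ℝ) (hconv : ConvexOn ℝ Set.univ φ) (hnonneg : ∀ u, 0 ≤ φ u)
    (hbot : Tendsto φ atBot (nhds 0)) (htop : Tendsto φ atTop atTop)
    (u₀ : ℕ → ℝ) (hu₀pos : ∀ i, 0 < u₀ i)
    (hno : ¬ ∃ α : ℝ, α ∈ Set.Ioo (0 : ℝ) 1 ∧ ∃ ε : ℝ, 0 < ε ∧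
      ∃ c : ℕ → EReal, (∀ i, c i ≠ ⊤) ∧ (∑' i, phiE φ (c i) < ⊤) ∧
        ∀ i : ℕ, ∀ u : ℝ, c i < (u : EReal) → φ (u - u₀ i) < ε →
          α * φ u ≤ φ (u - u₀ i)) :
    ∃ (c : ℕ → ℕ → ℝ) (A : ℕ → Set ℕ),
      Pairwise (Function.onFun Disjoint A) ∧
      ∀ n : ℕ, 1 ≤ n →
        ((2 : ENNReal)⁻¹ ≤ ∑' i : A n, ENNReal.ofReal (φ (c n i)) ∧
         ∑' i : A n, ENNReal.ofReal (φ (c n i - u₀ i)) ≤ (2 : ENNReal)⁻¹ ^ n) := by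
  have hcont : Continuous φ := by
    rw [← continuousOn_univ]
    exact hconv.continuousOn isOpen_univ
  have hstep : ∀ n N : ℕ, ∃ (F : Finset ℕ) (c : ℕ → ℝ), (∀ i ∈ F, N ≤ i) ∧
      1 / 2 ≤ ∑ i ∈ F, φ (c i) ∧ ∑ i ∈ F, φ (c i - u₀ i) ≤ (1 / 2 : ℝ) ^ (n + 1) := by
    intro n N
    exact step_exists φ hcont hnonneg htop u₀ hno _
      ⟨by positivity, pow_lt_one₀ (by norm_num) (by norm_num) (by omega)⟩ N
  choose F c hF hlow hup using hstep
  let S : ℕ → ℕ := fun n => Nat.rec 0 (fun k s => max s ((F k s).sup id + 1)) n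
  have hS : ∀ n, S (n + 1) = max (S n) ((F n (S n)).sup id + 1) := fun n => rfl
  have hmono : Monotone S := monotone_nat_of_le_succ fun n => by
    rw [hS]; exact le_max_left _ _
  have hub : ∀ n, ∀ i ∈ F n (S n), i < S (n + 1) := by
    intro n i hi
    have h1 : i ≤ (F n (S n)).sup id := Finset.le_sup (f := id) hi
    have h2 := le_max_right (S n) ((F n (S n)).sup id + 1)
    rw [hS]
    omega
  have hdis : ∀ m n, m < n → Disjoint (F m (S m) : Set ℕ) (F n (S n) : Set ℕ) := by
    intro m n hmn
    rw [Set.disjoint_left]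
    intro i hi hj
    have h1 := hub m i hi
    have h2 := hF n (S n) i hj
    have h3 : S (m + 1) ≤ S n := hmono hmn
    omega
  refine ⟨fun n => c n (S n), fun n => (F n (S n) : Set ℕ), ?_, ?_⟩
  · intro m n hmn
    rcases lt_or_gt_of_ne hmn with h | h
    · exact hdis m n h
    · exact (hdis n m h).symm
  · intro n _
    have key : ∀ g : ℕ → ℝ, (∀ i, 0 ≤ g i) →
        ∑' i : (F n (S n) : Set ℕ), ENNReal.ofReal (g i)
          = ENNReal.ofReal (∑ i ∈ F n (S n), g i) := by
      intro g hg
      rw [ENNReal.ofReal_sum_of_nonneg fun i _ => hg i]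
      exact Finset.tsum_subtype (F n (S n)) (fun i => ENNReal.ofReal (g i))
    have hhalf : ENNReal.ofReal (1 / 2) = (2 : ENNReal)⁻¹ := by
      rw [one_div, ENNReal.ofReal_inv_of_pos (by norm_num)]
      simp
    constructor
    · rw [key (fun i => φ (c n (S n) i)) fun i => hnonneg _, ← hhalf]
      exact ENNReal.ofReal_le_ofReal (hlow n (S n))
    · rw [key (fun i => φ (c n (S n) i - u₀ i)) fun i => hnonneg _, ← hhalf,
        ← ENNReal.ofReal_pow (by norm_num)]
      refine ENNReal.ofReal_le_ofReal ((hup n (S n)).trans ?_)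
      exact pow_le_pow_of_le_one (by norm_num) (by norm_num) (Nat.le_succ n)
end

section
/- Let φ be any deformed exponential. Then there exists a sequence {u_{0,i}}_{i≥1} of positive real numbers satisfying condition (C_seq) for φ; that is, in the purely atomic case (counting measure on ℕ), every deformed exponential admits such a sequence. -/
open Filter Set

/-- For any deformed exponential `φ` there is a sequence `{u_{0,i}}` of
positive reals satisfying condition (C_seq): for every sequence `{c_i} ⊂ ℝ` with
`Σ φ(c_i) < ∞` one has `Σ φ(c_i + λ u_{0,i}) < ∞` for all `λ > 0`. -/
theorem exists_u0_seq
    (φ : ℝ → ℝ) (hconv : ConvexOn ℝ Set.univ φ) (hnonneg : ∀ u, 0 ≤ φ u)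
    (hbot : Tendsto φ atBot (nhds 0)) (htop : Tendsto φ atTop atTop) :
    ∃ u₀ : ℕ → ℝ, (∀ i, 0 < u₀ i) ∧
      ∀ c : ℕ → ℝ, (∑' i, ENNReal.ofReal (φ (c i)) < ⊤) →
        ∀ lam : ℝ, 0 < lam → ∑' i, ENNReal.ofReal (φ (c i + lam * u₀ i)) < ⊤ := by
  refine ⟨fun i => (1 / 2 : ℝ) ^ i, fun i => by positivity, ?_⟩
  intro c hc lam hlam
  set S := ∑' i, ENNReal.ofReal (φ (c i)) with hS
  have hle : ∀ i, φ (c i) ≤ S.toReal := fun i => by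
    rw [← ENNReal.ofReal_le_iff_le_toReal hc.ne]
    exact ENNReal.le_tsum i
  obtain ⟨K, hK⟩ := (htop.eventually_gt_atTop S.toReal).exists_forall_of_atTop
  have hcK : ∀ i, c i < K := fun i => by
    by_contra! h
    exact absurd (hle i) (not_le.mpr (hK _ h))
  set L := φ (K + lam + 1) - φ (K + lam) with hL
  have key : ∀ i, φ (c i + lam * (1 / 2 : ℝ) ^ i) ≤ φ (c i) + L * (lam * (1 / 2 : ℝ) ^ i) := by
    intro i
    have hp : (0 : ℝ) < (1 / 2 : ℝ) ^ i := by positivity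
    have hp1 : (1 / 2 : ℝ) ^ i ≤ 1 := pow_le_one₀ (by norm_num) (by norm_num)
    have hh : 0 < lam * (1 / 2 : ℝ) ^ i := by positivity
    have hh1 : lam * (1 / 2 : ℝ) ^ i ≤ lam := by nlinarith
    generalize lam * (1 / 2 : ℝ) ^ i = h at hh hh1
    have hc' := hcK i
    have h1 := hconv.slope_mono_adjacent (mem_univ (c i)) (mem_univ (K + lam))
      (show c i < c i + h by linarith) (show c i + h < K + lam by linarith)
    have h2 := hconv.slope_mono_adjacent (mem_univ (c i + h)) (mem_univ (K + lam + 1))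
      (show c i + h < K + lam by linarith) (show K + lam < K + lam + 1 by linarith)
    have h3 := h1.trans h2
    rw [add_sub_cancel_left, add_sub_cancel_left, div_one, div_le_iff₀ hh] at h3
    linarith
  have hsum : Summable fun i : ℕ => L * (lam * (1 / 2 : ℝ) ^ i) :=
    (summable_geometric_two.mul_left lam).mul_left L
  calc ∑' i, ENNReal.ofReal (φ (c i + lam * (1 / 2 : ℝ) ^ i))
      ≤ ∑' i, (ENNReal.ofReal (φ (c i)) + ENNReal.ofReal (L * (lam * (1 / 2 : ℝ) ^ i))) :=
        ENNReal.tsum_le_tsum fun i =>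
          (ENNReal.ofReal_le_ofReal (key i)).trans ENNReal.ofReal_add_le
    _ = S + ∑' i, ENNReal.ofReal (L * (lam * (1 / 2 : ℝ) ^ i)) := ENNReal.tsum_add
    _ < ⊤ := ENNReal.add_lt_top.mpr ⟨hc, hsum.tsum_ofReal_lt_top⟩
end
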